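/- Let Γ = {v} * W be a star with ℓ = |W| ≥ 2, so that A_Γ ≅ ℤ × F⟨W⟩ with center generated by v. Every automorphism of A_Γ preserves the center and hence induces automorphisms of ⟨v⟩ ≅ ℤ and of A_Γ/Z(A_Γ) ≅ F⟨W⟩; the resulting homomorphism Out(A_Γ) → Out(ℤ) × Out(F⟨W⟩) is a split surjection whose kernel is the free abelian group of rank ℓ generated by the classes of the leaf transvections. Consequently, Out(A_Γ) ≅ ℤ^ℓ ⋊ (ℤ/2 × Out(F⟨W⟩)). -/

import Mathlib

noncomputable section

/-! ### Outer automorphism groups -/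

/-- The subgroup of inner automorphisms of `G` inside `MulAut G`. -/
def Inn (G : Type*) [Group G] : Subgroup (MulAut G) := (MulAut.conj : G →* MulAut G).range

instance Inn.normal (G : Type*) [Group G] : (Inn G).Normal := by
  constructor
  intro n hn φ
  obtain ⟨g, rfl⟩ := hn
  refine ⟨φ g, ?_⟩
  ext x
  simp [MulAut.conj_apply, MulAut.mul_apply, map_mul, map_inv, mul_assoc]

/-- The outer automorphism group of `G`. -/
abbrev Out (G : Type*) [Group G] := MulAut G ⧸ Inn G

/-! ### Right-angled Artin groups -/

variable {V : Type*}

/-- The commutator relations defining a right-angled Artin group. -/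
def raagRels (Γ : SimpleGraph V) : Set (FreeGroup V) :=
  {r | ∃ v w : V, Γ.Adj v w ∧
    r = FreeGroup.of v * FreeGroup.of w * (FreeGroup.of v)⁻¹ * (FreeGroup.of w)⁻¹}

/-- The right-angled Artin group associated to a simple graph. -/
abbrev RAAG (Γ : SimpleGraph V) := PresentedGroup (raagRels Γ)

/-- The generator of `RAAG Γ` corresponding to a vertex. -/
def raagGen (Γ : SimpleGraph V) (v : V) : RAAG Γ := PresentedGroup.of v

/-- The special subgroup generated by the vertices in `Θ`. -/
def SpecialSubgroup (Γ : SimpleGraph V) (Θ : Set V) : Subgroup (RAAG Γ) :=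
  Subgroup.closure (raagGen Γ '' Θ)

/-! ### Graph-theoretic notions -/

/-- The link of a vertex. -/
def lk (Γ : SimpleGraph V) (v : V) : Set V := Γ.neighborSet v

/-- The (closed) star of a vertex. -/
def starOf (Γ : SimpleGraph V) (v : V) : Set V := insert v (Γ.neighborSet v)

/-- `Θ⊥`: the intersection of the closed stars of the vertices of `Θ`. -/
def perp (Γ : SimpleGraph V) (Θ : Set V) : Set V := ⋂ v ∈ Θ, starOf Γ v

/-- A leaf is a vertex of valence one. -/
def IsLeaf (Γ : SimpleGraph V) (v : V) : Prop := ∃ w, Γ.neighborSet v = {w}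

/-- The vertex set of the maximal join `J_v = L_v * L_v⊥` associated to a vertex `v`. -/
def JoinOf (Γ : SimpleGraph V) (v : V) : Set V := lk Γ v ∪ perp Γ (lk Γ v)

/-- A vertex is cyclic if `L_v⊥ = {v}`. -/
def IsCyclicVertex (Γ : SimpleGraph V) (v : V) : Prop := perp Γ (lk Γ v) = {v}

/-- `C` is a connected component of the full subgraph of `Γ` spanned by `S`. -/
def IsComponentOf (Γ : SimpleGraph V) (S C : Set V) : Prop :=
  C ⊆ S ∧ C.Nonempty ∧ (Γ.induce C).Connected ∧
    ∀ x ∈ C, ∀ y ∈ S, Γ.Adj x y → y ∈ C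

/-- A separating vertex: `Γ − {v}` is disconnected. -/
def IsSeparating (Γ : SimpleGraph V) (v : V) : Prop :=
  Set.Nonempty ({v}ᶜ : Set V) ∧ ¬ (Γ.induce ({v}ᶜ : Set V)).Connected

/-- `δ_C(v)`: the number of connected components of `Γ − {v}`. -/
noncomputable def deltaC (Γ : SimpleGraph V) (v : V) : ℕ :=
  {C : Set V | IsComponentOf Γ ({v}ᶜ : Set V) C}.ncard

/-- `ℓ(v)`: the number of leaves adjacent to `v`. -/
noncomputable def nAdjLeaves (Γ : SimpleGraph V) (v : V) : ℕ :=
  {w : V | Γ.Adj v w ∧ IsLeaf Γ w}.ncard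

/-- A twig at `v`: a non-singleton component of `Γ − {v}` contained in the ball of
radius 2 about `v` (as a metric space, so every edge must have an endpoint adjacent
to `v`). -/
def IsTwigOf (Γ : SimpleGraph V) (v : V) (C : Set V) : Prop :=
  IsComponentOf Γ ({v}ᶜ : Set V) C ∧ (¬ ∃ w, C = {w}) ∧
  (∀ x ∈ C, Γ.dist v x ≤ 2) ∧
  ∀ x ∈ C, ∀ y ∈ C, Γ.Adj x y → (Γ.Adj v x ∨ Γ.Adj v y)

/-- `τ(v)`: the number of twigs at `v`. -/
noncomputable def nTwigs (Γ : SimpleGraph V) (v : V) : ℕ := {C : Set V | IsTwigOf Γ v C}.ncard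

/-- `Γ` is the star `{v} * W`. -/
def IsStarGraph (Γ : SimpleGraph V) (v : V) : Prop :=
  ∀ x y, Γ.Adj x y ↔ (x = v ∧ y ≠ v) ∨ (y = v ∧ x ≠ v)

/-- The link-equivalence class of `v` is maximal. -/
def HasMaximalLink (Γ : SimpleGraph V) (v : V) : Prop :=
  ∀ w, lk Γ v ⊆ lk Γ w → lk Γ w = lk Γ v

/-- `V0` is a set of representatives, one from each maximal link-equivalence class
(with the convention `V0 = {v}` when `Γ` is a star `{v} * W`). -/
def IsV0 (Γ : SimpleGraph V) (V0 : Set V) : Prop :=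
  (∃ v, IsStarGraph Γ v ∧ V0 = {v}) ∨
  ((¬ ∃ v, IsStarGraph Γ v) ∧
    (∀ v ∈ V0, HasMaximalLink Γ v) ∧
    (∀ v ∈ V0, ∀ w ∈ V0, lk Γ v = lk Γ w → v = w) ∧
    (∀ w, HasMaximalLink Γ w → ∃ v ∈ V0, lk Γ v = lk Γ w))

/-- A join `U * W` (as a full subgraph of `Γ`): a complete bipartite full subgraph. -/
def IsJoin (Γ : SimpleGraph V) (U W : Set V) : Prop :=
  U.Nonempty ∧ W.Nonempty ∧ Disjoint U W ∧
  (∀ u ∈ U, ∀ w ∈ W, Γ.Adj u w) ∧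
  (∀ u ∈ U, ∀ u' ∈ U, ¬ Γ.Adj u u') ∧
  (∀ w ∈ W, ∀ w' ∈ W, ¬ Γ.Adj w w')

/-- A maximal join: a join not properly contained in any other join subgraph. -/
def IsMaximalJoin (Γ : SimpleGraph V) (U W : Set V) : Prop :=
  IsJoin Γ U W ∧ ∀ U' W', IsJoin Γ U' W' → U ∪ W ⊆ U' ∪ W' → U ∪ W = U' ∪ W'

/-! ### Generating automorphisms and `Aut⁰`, `Out⁰` -/

/-- `φ` is the inversion at the vertex `v`. -/
def IsInversionAt (Γ : SimpleGraph V) (φ : MulAut (RAAG Γ)) (v : V) : Prop :=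
  φ (raagGen Γ v) = (raagGen Γ v)⁻¹ ∧ ∀ w, w ≠ v → φ (raagGen Γ w) = raagGen Γ w

/-- `φ` conjugates the generators in `C` by `v` and fixes all other generators. -/
def IsPartialConjBy (Γ : SimpleGraph V) (φ : MulAut (RAAG Γ)) (v : V) (C : Set V) : Prop :=
  (∀ x ∈ C, φ (raagGen Γ x) = (raagGen Γ v)⁻¹ * raagGen Γ x * raagGen Γ v) ∧
  (∀ x, x ∉ C → φ (raagGen Γ x) = raagGen Γ x)

/-- `φ` is the (right) transvection `w ↦ wv` (defined when `st(v) ⊇ lk(w)`). -/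
def IsTransvection (Γ : SimpleGraph V) (φ : MulAut (RAAG Γ)) (w v : V) : Prop :=
  v ≠ w ∧ lk Γ w ⊆ starOf Γ v ∧
  φ (raagGen Γ w) = raagGen Γ w * raagGen Γ v ∧
  ∀ x, x ≠ w → φ (raagGen Γ x) = raagGen Γ x

/-- The group of pure automorphisms `Aut⁰(A_Γ)`. -/
def Aut0 (Γ : SimpleGraph V) : Subgroup (MulAut (RAAG Γ)) :=
  Subgroup.closure
    ({φ | φ ∈ Inn (RAAG Γ)} ∪ {φ | ∃ v, IsInversionAt Γ φ v} ∪
     {φ | ∃ v C, IsComponentOf Γ ((starOf Γ v)ᶜ) C ∧ IsPartialConjBy Γ φ v C} ∪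
     {φ | ∃ w v, IsTransvection Γ φ w v})

/-- The group of pure outer automorphisms `Out⁰(A_Γ)`. -/
def Out0 (Γ : SimpleGraph V) : Subgroup (Out (RAAG Γ)) :=
  (Aut0 Γ).map (QuotientGroup.mk' (Inn (RAAG Γ)))


/-- The set of outer automorphism classes of leaf transvections. -/
def LeafTransvectionClasses (Γ : SimpleGraph V) : Set (Out (RAAG Γ)) :=
  {φ | ∃ ψ : MulAut (RAAG Γ), QuotientGroup.mk' (Inn (RAAG Γ)) ψ = φ ∧
    ∃ w v, IsLeaf Γ w ∧ Γ.Adj v w ∧ IsTransvection Γ ψ w v}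

/-! ### Functoriality of outer automorphism groups -/

/-- Isomorphic groups have isomorphic outer automorphism groups. -/
def Out.congr {G H : Type*} [Group G] [Group H] (e : G ≃* H) : Out G ≃* Out H :=
  QuotientGroup.congr (Inn G) (Inn H) (MulAut.congr e) <| by
    ext φ
    constructor
    · rintro ⟨_, ⟨g, rfl⟩, rfl⟩
      exact ⟨e g, by ext x; simp [MulAut.congr]⟩
    · rintro ⟨h, rfl⟩
      exact ⟨MulAut.conj (e.symm h), ⟨e.symm h, rfl⟩, by ext x; simp [MulAut.congr]⟩

theorem Out.congr_mk {G H : Type*} [Group G] [Group H] (e : G ≃* H) (ψ : MulAut G) :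
    Out.congr e (QuotientGroup.mk' (Inn G) ψ) =
      QuotientGroup.mk' (Inn H) (MulAut.congr e ψ) :=
  rfl

/-! ### Free groups of rank at least two are centerless -/

theorem FreeGroup.center_eq_bot {α : Type*} [Nontrivial α] :
    Subgroup.center (FreeGroup α) = ⊥ := by
  classical
  rw [eq_bot_iff]
  intro z hz
  by_contra hne
  have hL : z.toWord ≠ [] := fun h => hne (FreeGroup.toWord_eq_nil_iff.1 h)
  obtain ⟨⟨x, b⟩, L, hxL⟩ := List.exists_cons_of_ne_nil hL
  obtain ⟨y, hy⟩ := exists_ne x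
  have hred : FreeGroup.IsReduced ((y, true) :: z.toWord) := by
    have := FreeGroup.isReduced_toWord (x := z)
    rw [hxL] at this ⊢
    rw [FreeGroup.isReduced_cons_cons]
    exact ⟨fun h => absurd h hy, this⟩
  have hw : (FreeGroup.of y * z).toWord = (y, true) :: z.toWord := by
    rw [FreeGroup.toWord_mul, FreeGroup.toWord_of]
    exact hred.reduce_eq
  have hsub := FreeGroup.toWord_mul_sublist z (FreeGroup.of y)
  rw [← Subgroup.mem_center_iff.1 hz, hw, FreeGroup.toWord_of] at hsub
  have heq := hsub.eq_of_length (by simp)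
  rw [hxL] at heq
  exact hy (by simpa using congrArg (fun l => l.head?.map Prod.fst) heq)

/-! ### Automorphisms of the product of a centerless group and an abelian group -/

namespace ProdAut

variable {F C : Type*} [Group F] [CommGroup C]

theorem apply_inr_fst (hF : Subgroup.center F = ⊥) (ψ : MulAut (F × C)) (t : C) :
    (ψ (1, t)).1 = 1 := by
  rw [← Subgroup.mem_bot, ← hF, Subgroup.mem_center_iff]
  intro g
  obtain ⟨x, hx⟩ := ψ.surjective (g, 1)
  have h : x * (1, t) = (1, t) * x := by ext <;> simp [mul_comm]
  simpa [hx] using congrArg (fun y => (ψ y).1) h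

theorem apply_fst (hF : Subgroup.center F = ⊥) (ψ : MulAut (F × C)) (x : F × C) :
    (ψ x).1 = (ψ (x.1, 1)).1 := by
  have h : x = (x.1, 1) * (1, x.2) := by ext <;> simp
  conv_lhs => rw [h, map_mul, Prod.fst_mul, apply_inr_fst hF, mul_one]

theorem apply_inr (hF : Subgroup.center F = ⊥) (ψ : MulAut (F × C)) (t : C) :
    ψ (1, t) = (1, (ψ (1, t)).2) :=
  Prod.ext (apply_inr_fst hF ψ t) rfl

/-- The automorphism of the centerless factor, seen as the quotient by the center. -/
def onQuotient (hF : Subgroup.center F = ⊥) : MulAut (F × C) →* MulAut F where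
  toFun ψ :=
    { toFun := fun f => (ψ (f, 1)).1
      invFun := fun f => (ψ⁻¹ (f, 1)).1
      left_inv := fun f => by
        change (ψ⁻¹ ((ψ (f, 1)).1, 1)).1 = f
        rw [← apply_fst hF, MulAut.inv_apply_self]
      right_inv := fun f => by
        change (ψ ((ψ⁻¹ (f, 1)).1, 1)).1 = f
        rw [← apply_fst hF, MulAut.apply_inv_self]
      map_mul' := fun f g => by rw [← Prod.fst_mul, ← map_mul, Prod.mk_mul_mk, mul_one] }
  map_one' := rfl
  map_mul' φ ψ := by
    ext f
    exact apply_fst hF φ (ψ (f, 1))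

/-- The automorphism of the abelian factor, seen as the center. -/
def onCenter (hF : Subgroup.center F = ⊥) : MulAut (F × C) →* MulAut C where
  toFun ψ :=
    { toFun := fun t => (ψ (1, t)).2
      invFun := fun t => (ψ⁻¹ (1, t)).2
      left_inv := fun t => by
        change (ψ⁻¹ (1, (ψ (1, t)).2)).2 = t
        rw [← apply_inr hF, MulAut.inv_apply_self]
      right_inv := fun t => by
        change (ψ (1, (ψ⁻¹ (1, t)).2)).2 = t
        rw [← apply_inr hF, MulAut.apply_inv_self]
      map_mul' := fun s t => by rw [← Prod.snd_mul, ← map_mul, Prod.mk_mul_mk, mul_one] }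
  map_one' := rfl
  map_mul' φ ψ := by
    ext t
    change (φ (ψ (1, t))).2 = (φ (1, (ψ (1, t)).2)).2
    rw [← apply_inr hF]

@[simp]
theorem onQuotient_apply (hF : Subgroup.center F = ⊥) (ψ : MulAut (F × C)) (f : F) :
    onQuotient hF ψ f = (ψ (f, 1)).1 :=
  rfl

@[simp]
theorem onCenter_apply (hF : Subgroup.center F = ⊥) (ψ : MulAut (F × C)) (t : C) :
    onCenter hF ψ t = (ψ (1, t)).2 :=
  rfl

theorem onQuotient_conj (hF : Subgroup.center F = ⊥) (g : F × C) :
    onQuotient hF (MulAut.conj g) = MulAut.conj g.1 := by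
  ext f
  simp

theorem onCenter_conj (hF : Subgroup.center F = ⊥) (g : F × C) :
    onCenter hF (MulAut.conj g) = 1 := by
  ext t
  simp [mul_comm]

/-- The action of `Out (F × C)` on the center and on the quotient by the center. -/
def outMap (hF : Subgroup.center F = ⊥) : Out (F × C) →* MulAut C × Out F :=
  QuotientGroup.lift (Inn (F × C))
    ((onCenter hF).prod ((QuotientGroup.mk' (Inn F)).comp (onQuotient hF))) <| by
    rintro _ ⟨g, rfl⟩
    refine Prod.ext (onCenter_conj hF g) ?_
    refine (QuotientGroup.eq_one_iff _).2 ⟨g.1, ?_⟩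
    exact (onQuotient_conj hF g).symm

theorem outMap_mk (hF : Subgroup.center F = ⊥) (ψ : MulAut (F × C)) :
    outMap hF (QuotientGroup.mk' (Inn (F × C)) ψ) =
      (onCenter hF ψ, QuotientGroup.mk' (Inn F) (onQuotient hF ψ)) :=
  rfl

/-- The factorwise action as a homomorphism to `MulAut (F × C)`. -/
def factorwise : MulAut C × MulAut F →* MulAut (F × C) where
  toFun p := MulEquiv.prodCongr p.2 p.1
  map_one' := rfl
  map_mul' _ _ := rfl

@[simp]
theorem factorwise_apply (p : MulAut C × MulAut F) (x : F × C) :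
    factorwise p x = (p.2 x.1, p.1 x.2) :=
  rfl

/-- The homomorphism `MulAut C × Out F →* Out (F × C)` given by acting factorwise. -/
def outSection : MulAut C × Out F →* Out (F × C) :=
  MonoidHom.noncommCoprod
    ((QuotientGroup.mk' (Inn (F × C))).comp (factorwise.comp (MonoidHom.inl _ _)))
    (QuotientGroup.map (Inn F) (Inn (F × C)) (factorwise.comp (MonoidHom.inr _ _)) <| by
      rintro _ ⟨g, rfl⟩
      refine ⟨(g, 1), ?_⟩
      ext x <;> simp)
    (by
      intro γ η
      obtain ⟨η, rfl⟩ := QuotientGroup.mk'_surjective _ η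
      exact congrArg (QuotientGroup.mk' (Inn (F × C)))
        (by ext x <;> simp :
          factorwise (γ, 1) * factorwise (1, η) = factorwise (1, η) * factorwise (γ, 1)))

theorem outMap_outSection (hF : Subgroup.center F = ⊥) (p : MulAut C × Out F) :
    outMap hF (outSection p) = p := by
  obtain ⟨γ, η⟩ := p
  obtain ⟨η, rfl⟩ := QuotientGroup.mk'_surjective _ η
  change outMap hF (QuotientGroup.mk' (Inn (F × C)) (factorwise (γ, 1) * factorwise (1, η))) = _
  rw [outMap_mk]
  congr 1

/-- The transvection `(f, t) ↦ (f, μ f * t)`, as a homomorphism in `μ`. -/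
def transvection : (F →* C) →* MulAut (F × C) where
  toFun μ :=
    { toFun := fun x => (x.1, μ x.1 * x.2)
      invFun := fun x => (x.1, (μ x.1)⁻¹ * x.2)
      left_inv := fun x => by simp
      right_inv := fun x => by simp
      map_mul' := fun x y => by ext <;> simp [mul_mul_mul_comm] }
  map_one' := by ext x <;> simp
  map_mul' μ ν := by ext x <;> simp [mul_assoc]

@[simp]
theorem transvection_apply (μ : F →* C) (x : F × C) :
    transvection μ x = (x.1, μ x.1 * x.2) :=
  rfl

/-- The outer class of a transvection. -/
def outTransvection : (F →* C) →* Out (F × C) :=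
  (QuotientGroup.mk' (Inn (F × C))).comp transvection

theorem outTransvection_injective :
    Function.Injective (outTransvection : (F →* C) →* Out (F × C)) := by
  rw [injective_iff_map_eq_one]
  intro μ hμ
  obtain ⟨g, hg⟩ := (QuotientGroup.eq_one_iff _).1 hμ
  ext f
  simpa using (congrArg (fun ψ : MulAut (F × C) => (ψ (f, 1)).2) hg).symm

theorem exists_transvection (hF : Subgroup.center F = ⊥) {ψ : MulAut (F × C)}
    (hC : onCenter hF ψ = 1) (hQ : onQuotient hF ψ = 1) : ∃ μ, transvection μ = ψ := by
  refine ⟨(MonoidHom.snd F C).comp (ψ.toMonoidHom.comp (MonoidHom.inl F C)), ?_⟩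
  ext x
  · rw [apply_fst hF ψ x]
    simpa using (DFunLike.congr_fun hQ x.1).symm
  · have h : x = (x.1, 1) * (1, x.2) := by ext <;> simp
    have h2 : (ψ (1, x.2)).2 = x.2 := DFunLike.congr_fun hC x.2
    conv_rhs => rw [h, map_mul, Prod.snd_mul, h2]
    rfl

theorem ker_outMap (hF : Subgroup.center F = ⊥) :
    (outMap hF : Out (F × C) →* _).ker = outTransvection.range := by
  ext φ
  constructor
  · intro hφ
    obtain ⟨ψ, rfl⟩ := QuotientGroup.mk'_surjective _ φ
    rw [MonoidHom.mem_ker, outMap_mk, Prod.mk_eq_one] at hφ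
    obtain ⟨g, hg⟩ := (QuotientGroup.eq_one_iff _).1 hφ.2
    obtain ⟨μ, hμ⟩ := exists_transvection hF (ψ := (MulAut.conj (g, 1))⁻¹ * ψ)
      (by rw [map_mul, map_inv, onCenter_conj, hφ.1, inv_one, one_mul])
      (by rw [map_mul, map_inv, onQuotient_conj, ← hg, inv_mul_cancel])
    refine ⟨μ, ?_⟩
    have hconj : QuotientGroup.mk' (Inn (F × C)) (MulAut.conj (g, 1)) = 1 :=
      (QuotientGroup.eq_one_iff _).2 ⟨_, rfl⟩
    rw [outTransvection, MonoidHom.comp_apply, hμ, map_mul, map_inv, hconj, inv_one, one_mul]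
  · rintro ⟨μ, rfl⟩
    rw [MonoidHom.mem_ker, outTransvection, MonoidHom.comp_apply, outMap_mk, Prod.mk_eq_one]
    have hQ : onQuotient hF (transvection μ) = 1 := by ext; simp
    exact ⟨by ext; simp, by rw [hQ, map_one]⟩

end ProdAut

/-! ### Homomorphisms from a free group to the integers -/

/-- Homomorphisms from a free group to `ℤ` are determined by exponents on the generators. -/
def freeGroupHomInt (α : Type*) :
    Multiplicative (α → ℤ) ≃* (FreeGroup α →* Multiplicative ℤ) where
  toFun n := FreeGroup.lift fun a => Multiplicative.ofAdd (n.toAdd a)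
  invFun μ := Multiplicative.ofAdd fun a => (μ (FreeGroup.of a)).toAdd
  left_inv n := by simp
  right_inv μ := by ext a; simp
  map_mul' m n := by ext a; simp

@[simp]
theorem freeGroupHomInt_of {α : Type*} (n : Multiplicative (α → ℤ)) (a : α) :
    freeGroupHomInt α n (FreeGroup.of a) = Multiplicative.ofAdd (n.toAdd a) := by
  simp [freeGroupHomInt]

theorem closure_range_ofAdd_single {α : Type*} [Fintype α] [DecidableEq α] :
    Subgroup.closure (Set.range fun a : α => Multiplicative.ofAdd (Pi.single a (1 : ℤ))) = ⊤ := by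
  rw [eq_top_iff]
  intro n _
  have h : n = ∏ a, Multiplicative.ofAdd (Pi.single a (1 : ℤ)) ^ (n.toAdd a) := by
    apply Multiplicative.toAdd.injective
    ext b
    simp [toAdd_prod, Finset.sum_apply, Pi.single_apply]
  rw [h]
  exact Subgroup.prod_mem _ fun a _ =>
    Subgroup.zpow_mem _ (Subgroup.subset_closure (Set.mem_range_self a)) _

/-! ### The right-angled Artin group of a star -/

section Star

variable {Γ : SimpleGraph V} {c : V}

theorem raagGen_commute {x y : V} (h : Γ.Adj x y) : Commute (raagGen Γ x) (raagGen Γ y) := by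
  have := PresentedGroup.one_of_mem (rels := raagRels Γ)
    (show _ ∈ raagRels Γ from ⟨x, y, h, rfl⟩)
  rw [map_mul, map_mul, map_mul, map_inv, map_inv, mul_inv_eq_one, mul_inv_eq_iff_eq_mul] at this
  exact this

/-- The homomorphism from the free group on the leaves of a star. -/
def leafHom (Γ : SimpleGraph V) (c : V) : FreeGroup {x : V // x ≠ c} →* RAAG Γ :=
  FreeGroup.lift fun u => raagGen Γ ↑u

theorem leafHom_commute_center (hstar : IsStarGraph Γ c) (f : FreeGroup {x : V // x ≠ c}) :
    Commute (leafHom Γ c f) (raagGen Γ c) := by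
  induction f using FreeGroup.induction_on with
  | C1 => simp
  | of x => simpa [leafHom] using raagGen_commute ((hstar x c).2 (Or.inr ⟨rfl, x.2⟩))
  | inv_of x h => simpa using h.inv_left
  | mul x y hx hy => simpa using hx.mul_left hy

/-- The homomorphism from the right-angled Artin group of a star to the product of the free group
on the leaves and the infinite cyclic group generated by the center of the star. -/
def starHom [DecidableEq V] (hstar : IsStarGraph Γ c) :
    RAAG Γ →* FreeGroup {x : V // x ≠ c} × Multiplicative ℤ :=
  PresentedGroup.toGroup
    (f := fun x => if h : x = c then (1, Multiplicative.ofAdd 1) else (FreeGroup.of ⟨x, h⟩, 1)) <| by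
      rintro _ ⟨x, y, hxy, rfl⟩
      rcases (hstar x y).1 hxy with ⟨rfl, hy⟩ | ⟨rfl, hx⟩
      · simp [hy]
      · simp [hx]

theorem starHom_center [DecidableEq V] (hstar : IsStarGraph Γ c) :
    starHom hstar (raagGen Γ c) = (1, Multiplicative.ofAdd 1) := by
  simp [starHom, raagGen]

theorem starHom_leaf [DecidableEq V] (hstar : IsStarGraph Γ c) (w : {x : V // x ≠ c}) :
    starHom hstar (raagGen Γ ↑w) = (FreeGroup.of w, 1) := by
  simp [starHom, raagGen, w.2]

theorem starHom_comp_leafHom [DecidableEq V] (hstar : IsStarGraph Γ c) :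
    (starHom hstar).comp (leafHom Γ c) = MonoidHom.inl _ _ := by
  refine FreeGroup.ext_hom _ _ fun w => ?_
  simp [leafHom, starHom_leaf]

/-- The inverse of `starHom`. -/
def starInv (hstar : IsStarGraph Γ c) :
    FreeGroup {x : V // x ≠ c} × Multiplicative ℤ →* RAAG Γ :=
  MonoidHom.noncommCoprod (leafHom Γ c) (zpowersHom _ (raagGen Γ c)) fun f t => by
    simpa using (leafHom_commute_center hstar f).zpow_right t.toAdd

theorem starInv_apply (hstar : IsStarGraph Γ c)
    (x : FreeGroup {x : V // x ≠ c} × Multiplicative ℤ) :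
    starInv hstar x = leafHom Γ c x.1 * raagGen Γ c ^ x.2.toAdd := by
  simp [starInv]

/-- The right-angled Artin group of a star is the product of the free group on the leaves
and the infinite cyclic group generated by the center of the star. -/
def starEquiv [DecidableEq V] (hstar : IsStarGraph Γ c) :
    RAAG Γ ≃* FreeGroup {x : V // x ≠ c} × Multiplicative ℤ :=
  MonoidHom.toMulEquiv (starHom hstar) (starInv hstar)
    (by
      refine PresentedGroup.ext fun x => ?_
      change starInv hstar (starHom hstar (raagGen Γ x)) = raagGen Γ x
      by_cases h : x = c
      · subst h
        simp [starHom_center, starInv_apply]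
      · rw [starHom_leaf hstar ⟨x, h⟩]
        simp [starInv_apply, leafHom])
    (by
      refine MonoidHom.ext fun x => ?_
      have hx : starHom hstar (leafHom Γ c x.1) = (x.1, 1) :=
        DFunLike.congr_fun (starHom_comp_leafHom hstar) x.1
      rw [MonoidHom.comp_apply, starInv_apply, map_mul, hx, map_zpow, starHom_center]
      ext <;> simp [← ofAdd_zsmul])

theorem starEquiv_center [DecidableEq V] (hstar : IsStarGraph Γ c) :
    starEquiv hstar (raagGen Γ c) = (1, Multiplicative.ofAdd 1) :=
  starHom_center hstar

theorem starEquiv_leaf [DecidableEq V] (hstar : IsStarGraph Γ c) (w : {x : V // x ≠ c}) :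
    starEquiv hstar (raagGen Γ ↑w) = (FreeGroup.of w, 1) :=
  starHom_leaf hstar w

theorem starEquiv_symm_apply [DecidableEq V] (hstar : IsStarGraph Γ c)
    (x : FreeGroup {x : V // x ≠ c} × Multiplicative ℤ) :
    (starEquiv hstar).symm x = leafHom Γ c x.1 * raagGen Γ c ^ x.2.toAdd :=
  starInv_apply hstar x

theorem neighborSet_leaf (hstar : IsStarGraph Γ c) {w : V} (hw : w ≠ c) :
    Γ.neighborSet w = {c} := by
  ext x
  simp only [SimpleGraph.mem_neighborSet, hstar w x, Set.mem_singleton_iff]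
  tauto

theorem not_isLeaf_center [Nontrivial {x : V // x ≠ c}] (hstar : IsStarGraph Γ c) :
    ¬ IsLeaf Γ c := by
  rintro ⟨w, hw⟩
  obtain ⟨x, y, hxy⟩ := exists_pair_ne {x : V // x ≠ c}
  have h : ∀ u : {x : V // x ≠ c}, (u : V) = w := fun u =>
    (hw ▸ (hstar c u).2 (Or.inl ⟨rfl, u.2⟩) : (u : V) ∈ ({w} : Set V))
  exact hxy (Subtype.ext ((h x).trans (h y).symm))

/-- The automorphism multiplying each leaf of a star by a power of the center. -/
def starTransvection [DecidableEq V] (hstar : IsStarGraph Γ c) :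
    Multiplicative ({x : V // x ≠ c} → ℤ) →* MulAut (RAAG Γ) :=
  (MulAut.congr (starEquiv hstar)).symm.toMonoidHom.comp
    (ProdAut.transvection.comp (freeGroupHomInt _).toMonoidHom)

theorem starTransvection_center [DecidableEq V] (hstar : IsStarGraph Γ c)
    (n : Multiplicative ({x : V // x ≠ c} → ℤ)) :
    starTransvection hstar n (raagGen Γ c) = raagGen Γ c := by
  simp [starTransvection, MulAut.congr, starEquiv_center, starEquiv_symm_apply]

theorem starTransvection_leaf [DecidableEq V] (hstar : IsStarGraph Γ c)
    (n : Multiplicative ({x : V // x ≠ c} → ℤ)) (w : {x : V // x ≠ c}) :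
    starTransvection hstar n (raagGen Γ ↑w) = raagGen Γ ↑w * raagGen Γ c ^ n.toAdd w := by
  simp [starTransvection, MulAut.congr, starEquiv_leaf, starEquiv_symm_apply, leafHom]

theorem isTransvection_center_iff [DecidableEq V] (hstar : IsStarGraph Γ c)
    (ψ : MulAut (RAAG Γ)) (w : {x : V // x ≠ c}) :
    IsTransvection Γ ψ w c ↔
      ψ = starTransvection hstar (Multiplicative.ofAdd (Pi.single w 1)) := by
  constructor
  · rintro ⟨-, -, h1, h2⟩
    refine MulEquiv.toMonoidHom_injective (PresentedGroup.ext fun x => ?_)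
    change ψ (raagGen Γ x) = starTransvection hstar _ (raagGen Γ x)
    by_cases hx : x = c
    · subst hx
      rw [starTransvection_center, h2 _ w.2.symm]
    · rw [starTransvection_leaf hstar _ ⟨x, hx⟩]
      by_cases hw : x = w
      · subst hw
        simp [h1]
      · have : (⟨x, hx⟩ : {x : V // x ≠ c}) ≠ w := fun h => hw (congrArg Subtype.val h)
        simp [h2 x hw, this]
  · rintro rfl
    refine ⟨w.2.symm, ?_, ?_, fun x hw => ?_⟩
    · rw [lk, neighborSet_leaf hstar w.2, Set.singleton_subset_iff]
      exact Set.mem_insert _ _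
    · simp [starTransvection_leaf]
    · by_cases hx : x = c
      · subst hx
        exact starTransvection_center hstar _
      · rw [starTransvection_leaf hstar _ ⟨x, hx⟩]
        have : (⟨x, hx⟩ : {x : V // x ≠ c}) ≠ w := fun h => hw (congrArg Subtype.val h)
        simp [this]

/-- The outer class of `starTransvection`. -/
def outStarTransvection [DecidableEq V] (hstar : IsStarGraph Γ c) :
    Multiplicative ({x : V // x ≠ c} → ℤ) →* Out (RAAG Γ) :=
  (QuotientGroup.mk' (Inn (RAAG Γ))).comp (starTransvection hstar)

theorem leafTransvectionClasses_star [DecidableEq V] [Nontrivial {x : V // x ≠ c}]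
    (hstar : IsStarGraph Γ c) :
    LeafTransvectionClasses Γ = outStarTransvection hstar ''
      Set.range fun w : {x : V // x ≠ c} => Multiplicative.ofAdd (Pi.single w (1 : ℤ)) := by
  ext φ
  constructor
  · rintro ⟨ψ, rfl, w, v, hw, hvw, hψ⟩
    have hwc : w ≠ c := fun h => not_isLeaf_center hstar (h ▸ hw)
    obtain rfl : v = c := by
      have := (hstar v w).1 hvw
      tauto
    exact ⟨_, ⟨⟨w, hwc⟩, rfl⟩,
      congrArg _ ((isTransvection_center_iff hstar ψ ⟨w, hwc⟩).1 hψ).symm⟩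
  · rintro ⟨_, ⟨w, rfl⟩, rfl⟩
    exact ⟨_, rfl, w, c, ⟨c, neighborSet_leaf hstar w.2⟩, (hstar c w).2 (Or.inl ⟨rfl, w.2⟩),
      (isTransvection_center_iff hstar _ w).2 rfl⟩

theorem outCongr_outStarTransvection [DecidableEq V] (hstar : IsStarGraph Γ c)
    (n : Multiplicative ({x : V // x ≠ c} → ℤ)) :
    Out.congr (starEquiv hstar) (outStarTransvection hstar n) =
      ProdAut.outTransvection (freeGroupHomInt _ n) := by
  rw [outStarTransvection, MonoidHom.comp_apply, Out.congr_mk]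
  exact congrArg (QuotientGroup.mk' _) ((MulAut.congr (starEquiv hstar)).apply_symm_apply _)

theorem outStarTransvection_injective [DecidableEq V] (hstar : IsStarGraph Γ c) :
    Function.Injective (outStarTransvection hstar) := by
  intro m n h
  have := congrArg (Out.congr (starEquiv hstar)) h
  rw [outCongr_outStarTransvection, outCongr_outStarTransvection] at this
  exact (freeGroupHomInt _).injective (ProdAut.outTransvection_injective this)

/-- The action of the outer automorphism group of `RAAG Γ`, for `Γ` a star, on the center and on
the quotient by the center. -/
def outStarMap [DecidableEq V] [Nontrivial {x : V // x ≠ c}] (hstar : IsStarGraph Γ c) :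
    Out (RAAG Γ) →* MulAut (Multiplicative ℤ) × Out (FreeGroup {x : V // x ≠ c}) :=
  (ProdAut.outMap FreeGroup.center_eq_bot).comp (Out.congr (starEquiv hstar)).toMonoidHom

theorem ker_outStarMap [DecidableEq V] [Nontrivial {x : V // x ≠ c}] (hstar : IsStarGraph Γ c) :
    (outStarMap hstar).ker = (outStarTransvection hstar).range := by
  ext φ
  have h : φ ∈ (outStarMap hstar).ker ↔ Out.congr (starEquiv hstar) φ ∈
      (ProdAut.outMap (C := Multiplicative ℤ)
        (FreeGroup.center_eq_bot (α := {x : V // x ≠ c}))).ker := Iff.rfl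
  rw [h, ProdAut.ker_outMap, MonoidHom.mem_range, MonoidHom.mem_range,
    (freeGroupHomInt _).surjective.exists]
  simp only [← outCongr_outStarTransvection hstar, EmbeddingLike.apply_eq_iff_eq]

theorem outStarMap_apply_center [DecidableEq V] [Nontrivial {x : V // x ≠ c}]
    (hstar : IsStarGraph Γ c) (ψ : MulAut (RAAG Γ)) :
    ψ (raagGen Γ c) = raagGen Γ c ^ (Multiplicative.toAdd
      ((outStarMap hstar (QuotientGroup.mk' (Inn (RAAG Γ)) ψ)).1 (Multiplicative.ofAdd 1))) := by
  have hval : (outStarMap hstar (QuotientGroup.mk' (Inn (RAAG Γ)) ψ)).1 (Multiplicative.ofAdd 1) =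
      (MulAut.congr (starEquiv hstar) ψ (1, Multiplicative.ofAdd 1)).2 := rfl
  have h := ProdAut.apply_inr FreeGroup.center_eq_bot (MulAut.congr (starEquiv hstar) ψ)
    (Multiplicative.ofAdd 1)
  rw [← hval] at h
  rw [← starEquiv_center hstar] at h
  have h' := congrArg (starEquiv hstar).symm h
  rw [starEquiv_symm_apply hstar (1, _), map_one, one_mul] at h'
  rw [← h']
  simp [MulAut.congr]

theorem apply_leaf_eq [DecidableEq V] [Nontrivial {x : V // x ≠ c}]
    (hstar : IsStarGraph Γ c) (ψ : MulAut (RAAG Γ)) (w : {x : V // x ≠ c}) :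
    ∃ n : ℤ, ψ (raagGen Γ ↑w) =
      leafHom Γ c (ProdAut.onQuotient FreeGroup.center_eq_bot
        (MulAut.congr (starEquiv hstar) ψ) (FreeGroup.of w)) * raagGen Γ c ^ n := by
  refine ⟨(MulAut.congr (starEquiv hstar) ψ (FreeGroup.of w, 1)).2.toAdd, ?_⟩
  rw [ProdAut.onQuotient_apply, ← starEquiv_symm_apply hstar, ← starEquiv_leaf hstar]
  simp [MulAut.congr]

end Star

/-- For a star `Γ = {c} * W` with `|W| ≥ 2`, the homomorphism
`Out(A_Γ) → Out(ℤ) × Out(F⟨W⟩)` induced by the action on the center `⟨c⟩ ≅ ℤ` and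
on the quotient `A_Γ/Z(A_Γ) ≅ F⟨W⟩` is a split surjection whose kernel is the free
abelian group of rank `|W|` generated by the classes of the leaf transvections. -/
theorem out_of_star {V : Type*} [Fintype V] [DecidableEq V] (Γ : SimpleGraph V)
    (c : V) (hstar : IsStarGraph Γ c) (hW : 2 ≤ Fintype.card {x : V // x ≠ c}) :
    ∃ Φ : Out (RAAG Γ) →* MulAut (Multiplicative ℤ) × Out (FreeGroup {x : V // x ≠ c}),
      (∀ ψ : MulAut (RAAG Γ),
        ψ (raagGen Γ c) = raagGen Γ c ^
          (Multiplicative.toAdd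
            ((Φ (QuotientGroup.mk' (Inn (RAAG Γ)) ψ)).1 (Multiplicative.ofAdd (1 : ℤ)))) ∧
        ∃ η : MulAut (FreeGroup {x : V // x ≠ c}),
          QuotientGroup.mk' (Inn (FreeGroup {x : V // x ≠ c})) η =
            (Φ (QuotientGroup.mk' (Inn (RAAG Γ)) ψ)).2 ∧
          ∀ w : {x : V // x ≠ c}, ∃ n : ℤ,
            ψ (raagGen Γ ↑w) =
              FreeGroup.lift (fun u : {x : V // x ≠ c} => raagGen Γ ↑u)
                  (η (FreeGroup.of w)) * raagGen Γ c ^ n) ∧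
      Function.Surjective Φ ∧
      (∃ s : MulAut (Multiplicative ℤ) × Out (FreeGroup {x : V // x ≠ c}) →* Out (RAAG Γ),
        Φ.comp s = MonoidHom.id _) ∧
      Φ.ker = Subgroup.closure (LeafTransvectionClasses Γ) ∧
      Nonempty (Φ.ker ≃* Multiplicative ({x : V // x ≠ c} → ℤ)) := by
  have : Nontrivial {x : V // x ≠ c} := Fintype.one_lt_card_iff_nontrivial.1 hW
  have hsec : (outStarMap hstar).comp
      ((Out.congr (starEquiv hstar)).symm.toMonoidHom.comp ProdAut.outSection) =
        MonoidHom.id _ := by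
    refine MonoidHom.ext fun p => ?_
    change ProdAut.outMap _ (Out.congr (starEquiv hstar) ((Out.congr (starEquiv hstar)).symm _)) = p
    rw [MulEquiv.apply_symm_apply, ProdAut.outMap_outSection]
  refine ⟨outStarMap hstar, fun ψ => ⟨outStarMap_apply_center hstar ψ, _, rfl,
    apply_leaf_eq hstar ψ⟩, fun p => ⟨_, DFunLike.congr_fun hsec p⟩, ⟨_, hsec⟩, ?_, ?_⟩
  · rw [ker_outStarMap, leafTransvectionClasses_star hstar, ← MonoidHom.map_closure,
      closure_range_ofAdd_single, MonoidHom.range_eq_map]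
  · rw [ker_outStarMap]
    exact ⟨(MonoidHom.ofInjective (outStarTransvection_injective hstar)).symm⟩
end
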